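/- arXiv:1210.1460 — 7 statements merged into one kernel-verified Lean document; each statement's English description precedes it below -/
import Mathlib

section
/- For every real number M there exist a finite simple connected graph G and three vertices x1, x2, x3 of G such that Epidemic(x1,x2) + Epidemic(x2,x3) ≤ 7 while Epidemic(x1,x3) > M. In particular, the epidemic quasimetric fails the triangle inequality arbitrarily badly. -/
open scoped BigOperators

/-- Number of edges of the subgraph of `G` induced by the ball of radius `r` around `x`. -/
noncomputable def ballEdges {V : Type*} (G : SimpleGraph V) (x : V) (r : ℕ) : ℕ :=
  {e ∈ G.edgeSet | ∀ v ∈ e, G.dist x v ≤ r}.ncard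

/-- The epidemic quasimetric `Epidemic(x,y) = |Ω(x,d(x,y))| + |Ω(y,d(x,y))|`. -/
noncomputable def epidemic {V : Type*} (G : SimpleGraph V) (x y : V) : ℕ :=
  ballEdges G x (G.dist x y) + ballEdges G y (G.dist x y)


/-- The path `0 - 1 - 2 - 3` with `n` further leaves attached to the vertex `3`. -/
def broom (n : ℕ) : SimpleGraph (Fin (n + 4)) where
  Adj i j := (0 < j.val ∧ i.val = min (j.val - 1) 3) ∨ (0 < i.val ∧ j.val = min (i.val - 1) 3)
  symm := ⟨fun _ _ h => h.symm⟩
  loopless := ⟨fun i h => by omega⟩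

theorem broom_adj (n : ℕ) (i j : Fin (n + 4)) : (broom n).Adj i j ↔
    (0 < j.val ∧ i.val = min (j.val - 1) 3) ∨ (0 < i.val ∧ j.val = min (i.val - 1) 3) := Iff.rfl

theorem broom_connected (n : ℕ) : (broom n).Connected := by
  have key : ∀ k : ℕ, ∀ h : k < n + 4, (broom n).Reachable ⟨0, by omega⟩ ⟨k, h⟩ := by
    intro k
    induction k using Nat.strong_induction_on with
    | _ k ih =>
      intro h
      rcases Nat.eq_zero_or_pos k with rfl | hk
      · exact SimpleGraph.Reachable.refl _
      · have h1 := ih (min (k - 1) 3) (by omega) (by omega)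
        refine h1.trans (SimpleGraph.Adj.reachable ?_)
        exact Or.inl ⟨hk, rfl⟩
  have : Nonempty (Fin (n + 4)) := ⟨⟨0, by omega⟩⟩
  refine SimpleGraph.Connected.mk ?_
  intro a b
  exact (key a.1 a.2).symm.trans (key b.1 b.2)

theorem broom_dist_le_one (n : ℕ) (x v : Fin (n + 4)) (h : (broom n).dist x v ≤ 1) :
    x.val = v.val ∨ (broom n).Adj x v := by
  rcases Nat.le_one_iff_eq_zero_or_eq_one.1 h with h | h
  · left
    rw [((broom_connected n).dist_eq_zero_iff).1 h]
  · right
    exact SimpleGraph.dist_eq_one_iff_adj.1 h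

theorem broom_ball (n : ℕ) (x : Fin (n + 4)) (s : Finset (Sym2 (Fin (n + 4))))
    (h : ∀ a b : Fin (n + 4), (broom n).Adj a b → (x.val = a.val ∨ (broom n).Adj x a) →
      (x.val = b.val ∨ (broom n).Adj x b) → s(a, b) ∈ s) : ballEdges (broom n) x 1 ≤ s.card := by
  unfold ballEdges
  rw [← Set.ncard_coe_finset]
  refine Set.ncard_le_ncard ?_ s.finite_toSet
  intro e
  induction e with
  | _ a b =>
    rintro ⟨he, hv⟩
    exact h a b he (broom_dist_le_one n x a (hv a (Sym2.mem_mk_left a b)))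
      (broom_dist_le_one n x b (hv b (Sym2.mem_mk_right a b)))

theorem broom_ball_big (n r : ℕ) (hr : 2 ≤ r) :
    n ≤ ballEdges (broom n) ⟨2, by omega⟩ r := by
  have h23 : (broom n).Adj ⟨2, by omega⟩ ⟨3, by omega⟩ := by
    rw [broom_adj]; simp
  let f : Fin n → Sym2 (Fin (n + 4)) := fun j => s(⟨3, by omega⟩, ⟨j.val + 4, by omega⟩)
  have hf : Function.Injective f := by
    intro a b hab
    simp only [f, Sym2.eq_iff, Fin.mk.injEq] at hab
    apply Fin.ext
    omega
  have : (Set.range f).ncard = n := by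
    rw [← Set.image_univ, Set.ncard_image_of_injective _ hf, Set.ncard_univ, Nat.card_fin]
  unfold ballEdges
  refine this.symm.le.trans ?_
  refine Set.ncard_le_ncard ?_ (Set.toFinite _)
  rintro _ ⟨j, rfl⟩
  have h3 : (broom n).Adj ⟨3, by omega⟩ ⟨j.val + 4, by omega⟩ := by
    rw [broom_adj]; simp
  refine ⟨h3, ?_⟩
  intro v hv
  rcases Sym2.mem_iff.1 hv with rfl | rfl
  · have := SimpleGraph.dist_le h23.toWalk
    simp at this
    omega
  · have := SimpleGraph.dist_le (SimpleGraph.Walk.cons h23 h3.toWalk)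
    simp at this
    omega

theorem epidemic_triangle_inequality_fails_badly (M : ℝ) :
    ∃ (V : Type) (_ : Fintype V) (G : SimpleGraph V), G.Connected ∧
      ∃ x1 x2 x3 : V,
        epidemic G x1 x2 + epidemic G x2 x3 ≤ 7 ∧ M < (epidemic G x1 x3 : ℝ) := by
  obtain ⟨n, hn⟩ := exists_nat_gt M
  refine ⟨Fin (n + 4), inferInstance, broom n, broom_connected n,
    ⟨0, by omega⟩, ⟨1, by omega⟩, ⟨2, by omega⟩, ?_, ?_⟩
  · have h01 : (broom n).dist ⟨0, by omega⟩ ⟨1, by omega⟩ = 1 := by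
      rw [SimpleGraph.dist_eq_one_iff_adj, broom_adj]; simp
    have h12 : (broom n).dist ⟨1, by omega⟩ ⟨2, by omega⟩ = 1 := by
      rw [SimpleGraph.dist_eq_one_iff_adj, broom_adj]; simp
    unfold epidemic
    rw [h01, h12]
    have b0 := broom_ball n ⟨0, by omega⟩ {s(⟨0, by omega⟩, ⟨1, by omega⟩)} (by
      intro a b
      simp only [broom_adj, Finset.mem_singleton, Sym2.eq_iff, Fin.ext_iff]
      omega)
    have b1 := broom_ball n ⟨1, by omega⟩
      {s(⟨0, by omega⟩, ⟨1, by omega⟩), s(⟨1, by omega⟩, ⟨2, by omega⟩)} (by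
      intro a b
      simp only [broom_adj, Finset.mem_insert, Finset.mem_singleton, Sym2.eq_iff, Fin.ext_iff]
      omega)
    have b2 := broom_ball n ⟨2, by omega⟩
      {s(⟨1, by omega⟩, ⟨2, by omega⟩), s(⟨2, by omega⟩, ⟨3, by omega⟩)} (by
      intro a b
      simp only [broom_adj, Finset.mem_insert, Finset.mem_singleton, Sym2.eq_iff, Fin.ext_iff]
      omega)
    have b1' := b1.trans Finset.card_le_two
    have b2' := b2.trans Finset.card_le_two
    rw [Finset.card_singleton] at b0
    omega
  · refine hn.trans_le ?_
    have hd : 2 ≤ (broom n).dist ⟨0, by omega⟩ ⟨2, by omega⟩ := by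
      by_contra hc
      have := broom_dist_le_one n ⟨0, by omega⟩ ⟨2, by omega⟩ (by omega)
      simp [broom_adj] at this
    have := broom_ball_big n _ hd
    unfold epidemic
    exact_mod_cast this.trans (Nat.le_add_left _ _)
end

section
/- Existence for the Dirichlet problem: let G=(V,E) be a finite simple connected graph, B ⊆ V a nonempty set of boundary vertices, and h_B: B→ℝ any function. Then there exists a function h: V→ℝ with h(x) = h_B(x) for all x ∈ B which is harmonic at every vertex x ∉ B. -/
open scoped BigOperators

/-- `h` is harmonic at `x`: `h x` is the average of `h` over the neighbors of `x`. -/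
def HarmonicAt {V : Type*} (G : SimpleGraph V) (h : V → ℝ) (x : V) : Prop :=
  h x = (1 / ((G.neighborSet x).ncard : ℝ)) * ∑ᶠ y ∈ G.neighborSet x, h y

open Classical in
/-- The Dirichlet operator: identity on `B`, Laplacian off `B`. -/
noncomputable def dirOp {V : Type*} [Fintype V] (G : SimpleGraph V) (B : Set V) :
    (V → ℝ) →ₗ[ℝ] (V → ℝ) where
  toFun h x := if x ∈ B then h x else ∑ y ∈ (G.neighborSet x).toFinset, (h x - h y)
  map_add' f g := by
    funext x
    by_cases hx : x ∈ B
    · simp [hx]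
    · simp only [hx, if_false, Pi.add_apply, ← Finset.sum_add_distrib]
      exact Finset.sum_congr rfl fun y _ => by ring
  map_smul' c f := by
    funext x
    by_cases hx : x ∈ B
    · simp [hx]
    · simp only [hx, if_false, Pi.smul_apply, smul_eq_mul, RingHom.id_apply, Finset.mul_sum]
      exact Finset.sum_congr rfl fun y _ => by ring

theorem dirOp_max {V : Type*} [Fintype V] (G : SimpleGraph V) (B : Set V) (h : V → ℝ)
    (h0 : dirOp G B h = 0) (M : ℝ) (hM : ∀ x, h x ≤ M) {u b : V} (p : G.Walk u b)
    (hb : b ∈ B) (hu : h u = M) : M = 0 := by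
  classical
  induction p with
  | nil =>
    rename_i u
    have := congrFun h0 u
    simp only [dirOp, LinearMap.coe_mk, AddHom.coe_mk, hb, if_true, Pi.zero_apply] at this
    linarith
  | cons hadj p ih =>
    rename_i u v w
    have := congrFun h0 u
    simp only [dirOp, LinearMap.coe_mk, AddHom.coe_mk, Pi.zero_apply] at this
    split_ifs at this with hx
    · linarith
    · rw [Finset.sum_eq_zero_iff_of_nonneg
        (fun y _ => by have := hM y; linarith)] at this
      have h2 := this v (by simpa using hadj)
      exact ih hb (by linarith)

theorem dirOp_le {V : Type*} [Fintype V] (G : SimpleGraph V)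
    (hG : G.Connected) (B : Set V) (hB : B.Nonempty) (h : V → ℝ)
    (h0 : dirOp G B h = 0) (x : V) : h x ≤ 0 := by
  obtain ⟨b, hb⟩ := hB
  haveI : Nonempty V := ⟨b⟩
  obtain ⟨m, hm⟩ := Finite.exists_max h
  obtain ⟨p⟩ := hG.preconnected m b
  have := dirOp_max G B h h0 (h m) hm p hb rfl
  linarith [hm x]

theorem dirichlet_existence {V : Type*} [Fintype V] (G : SimpleGraph V)
    (hG : G.Connected) (B : Set V) (hB : B.Nonempty) (hB_fun : B → ℝ) :
    ∃ h : V → ℝ, (∀ x : V, (hx : x ∈ B) → h x = hB_fun ⟨x, hx⟩) ∧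
      ∀ x ∉ B, HarmonicAt G h x := by
  classical
  have inj : Function.Injective (dirOp G B) := by
    rw [injective_iff_map_eq_zero]
    intro h h0
    funext x
    have h1 := dirOp_le G hG B hB h h0 x
    have h2 := dirOp_le G hG B hB (-h) (by rw [map_neg, h0, neg_zero]) x
    simp only [Pi.neg_apply, Pi.zero_apply] at *
    linarith
  obtain ⟨h, hh⟩ := LinearMap.injective_iff_surjective.mp inj
    (fun x => if hx : x ∈ B then hB_fun ⟨x, hx⟩ else 0)
  refine ⟨h, fun x hx => ?_, fun x hx => ?_⟩
  · have := congrFun hh x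
    simpa [dirOp, hx] using this
  · have := congrFun hh x
    simp only [dirOp, LinearMap.coe_mk, AddHom.coe_mk, hx, if_false, dite_false,
      Finset.sum_sub_distrib, Finset.sum_const, nsmul_eq_mul] at this
    obtain ⟨b, hb⟩ := hB
    obtain ⟨p⟩ := hG.preconnected x b
    have hne : (G.neighborSet x).toFinset.Nonempty := by
      cases p with
      | nil => exact absurd hb hx
      | cons hadj p => exact ⟨_, by simpa using hadj⟩
    have hpos : ((G.neighborSet x).toFinset.card : ℝ) ≠ 0 := by
      exact_mod_cast hne.card_pos.ne'
    unfold HarmonicAt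
    rw [finsum_mem_eq_toFinset_sum, Set.ncard_eq_toFinset_card']
    field_simp
    linarith
end

section
/- Let G=(V,E) be a finite simple connected graph with edge resistances R: E→(0,∞), let a ≠ b be vertices, and let i be a unit current flow from a to b with potential v. Then Energy(i) = v(b) − v(a), and this quantity equals the effective resistance Reff(a,b). -/
open scoped BigOperators

/-- The divergence of `j` at `x`: the sum of `j x y` over the neighbors `y` of `x`. -/
noncomputable def flowDiv {V : Type*} (G : SimpleGraph V) (j : V → V → ℝ) (x : V) : ℝ :=
  ∑ᶠ y ∈ G.neighborSet x, j x y

/-- A flow from `a` to `b`: antisymmetric, supported on edges, divergence-free away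
from `a` and `b`. -/
def IsFlow {V : Type*} (G : SimpleGraph V) (a b : V) (j : V → V → ℝ) : Prop :=
  (∀ x y, j x y = - j y x) ∧
  (∀ x y, ¬ G.Adj x y → j x y = 0) ∧
  (∀ x, x ≠ a → x ≠ b → flowDiv G j x = 0)

/-- A unit flow from `a` to `b`: a flow with `div_j(a) = 1`. -/
def IsUnitFlow {V : Type*} (G : SimpleGraph V) (a b : V) (j : V → V → ℝ) : Prop :=
  IsFlow G a b j ∧ flowDiv G j a = 1

/-- The energy `(1/2) Σ_{x∼y} R({x,y}) j(x,y)²`, summed over ordered adjacent pairs. -/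
noncomputable def energy {V : Type*} (G : SimpleGraph V) (R : Sym2 V → ℝ)
    (j : V → V → ℝ) : ℝ :=
  (1 / 2) * ∑ᶠ x, ∑ᶠ y ∈ G.neighborSet x, R s(x, y) * (j x y) ^ 2

open Classical in
/-- The effective resistance: the infimum of the energies of unit flows from `a` to `b`,
with `Reff(a,a) = 0`. -/
noncomputable def Reff {V : Type*} (G : SimpleGraph V) (R : Sym2 V → ℝ) (a b : V) : ℝ :=
  if a = b then 0 else sInf {E | ∃ j, IsUnitFlow G a b j ∧ E = energy G R j}

lemma aux_finsum {V : Type*} [Fintype V] (G : SimpleGraph V) (f : V → ℝ) (x : V)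
    (hf : ∀ y, ¬ G.Adj x y → f y = 0) : ∑ᶠ y ∈ G.neighborSet x, f y = ∑ y, f y := by
  rw [← finsum_eq_sum_of_fintype]
  refine finsum_congr fun y => ?_
  by_cases h : G.Adj x y
  · simp [h]
  · simp [h, hf y h]

lemma aux_energy {V : Type*} [Fintype V] (G : SimpleGraph V) (R : Sym2 V → ℝ) (j : V → V → ℝ)
    (hj : ∀ x y, ¬ G.Adj x y → j x y = 0) :
    energy G R j = (1 / 2) * ∑ x, ∑ y, R s(x, y) * (j x y) ^ 2 := by
  unfold energy
  rw [finsum_eq_sum_of_fintype]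
  congr 1
  refine Finset.sum_congr rfl fun x _ => ?_
  apply aux_finsum G (fun y => R s(x, y) * (j x y) ^ 2)
  intro y h
  simp [hj x y h]

lemma aux_pair {V : Type*} [Fintype V] (G : SimpleGraph V) (a b : V) (hab : a ≠ b)
    (j : V → V → ℝ) (hj : IsUnitFlow G a b j) (v : V → ℝ) :
    ∑ x, ∑ y, (v y - v x) * j x y = 2 * (v b - v a) := by
  classical
  obtain ⟨⟨hanti, hsupp, hdiv⟩, hu⟩ := hj
  have hd : ∀ x, flowDiv G j x = ∑ y, j x y := fun x => aux_finsum G (j x) x (hsupp x)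
  simp only [hd] at hdiv hu
  have key : ∀ w : V → ℝ, ∑ x, w x * ∑ y, j x y = w a + w b * ∑ y, j b y := by
    intro w
    rw [← Finset.sum_subset (Finset.subset_univ {a, b}), Finset.sum_pair hab, hu, mul_one]
    intro x _ hx
    simp only [Finset.mem_insert, Finset.mem_singleton, not_or] at hx
    rw [hdiv x hx.1 hx.2, mul_zero]
  have hanti2 : ∀ f : V → V → ℝ, ∑ x, ∑ y, f x y * j x y = - ∑ x, ∑ y, f y x * j x y := by
    intro f
    rw [Finset.sum_comm, ← Finset.sum_neg_distrib]
    refine Finset.sum_congr rfl fun x _ => ?_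
    rw [← Finset.sum_neg_distrib]
    refine Finset.sum_congr rfl fun y _ => ?_
    rw [hanti y x]; ring
  have hb : ∑ y, j b y = -1 := by
    have h1 := key (fun _ => 1)
    have h2 := hanti2 (fun _ _ => 1)
    simp only [one_mul] at h1 h2
    linarith
  have h3 := hanti2 (fun _ y => v y)
  have h4 := key v
  simp only [Finset.mul_sum] at h4
  simp only [sub_mul, Finset.sum_sub_distrib]
  rw [← Finset.mul_sum, hb] at h4
  linarith

theorem energy_of_unit_current_flow {V : Type*} [Fintype V] (G : SimpleGraph V)
    (hG : G.Connected) (R : Sym2 V → ℝ) (hR : ∀ e ∈ G.edgeSet, 0 < R e)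
    (a b : V) (hab : a ≠ b) (i : V → V → ℝ) (v : V → ℝ)
    (hi : IsUnitFlow G a b i)
    (hOhm : ∀ x y, G.Adj x y → i x y = (v y - v x) / R s(x, y)) :
    energy G R i = v b - v a ∧ energy G R i = Reff G R a b := by
  have hRi : ∀ x y, G.Adj x y → v y - v x = R s(x, y) * i x y := by
    intro x y h
    have := hR s(x, y) h
    rw [hOhm x y h]
    field_simp
  have hE : energy G R i = v b - v a := by
    have h := aux_pair G a b hab i hi v
    rw [aux_energy G R i hi.1.2.1]
    have h2 : ∑ x, ∑ y, R s(x, y) * (i x y) ^ 2 = ∑ x, ∑ y, (v y - v x) * i x y := by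
      refine Finset.sum_congr rfl fun x _ => Finset.sum_congr rfl fun y _ => ?_
      by_cases hxy : G.Adj x y
      · rw [hRi x y hxy]; ring
      · simp [hi.1.2.1 x y hxy]
    rw [h2, h]; ring
  refine ⟨hE, ?_⟩
  have hmin : ∀ j, IsUnitFlow G a b j → energy G R i ≤ energy G R j := by
    intro j hj
    have h := aux_pair G a b hab j hj v
    have hle : ∑ x, ∑ y, 2 * ((v y - v x) * j x y) ≤
        ∑ x, ∑ y, (R s(x, y) * (j x y) ^ 2 + R s(x, y) * (i x y) ^ 2) := by
      refine Finset.sum_le_sum fun x _ => Finset.sum_le_sum fun y _ => ?_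
      by_cases hxy : G.Adj x y
      · rw [hRi x y hxy]
        have := mul_nonneg (hR s(x, y) hxy).le (sq_nonneg (j x y - i x y))
        linarith
      · simp [hi.1.2.1 x y hxy, hj.1.2.1 x y hxy]
    simp only [Finset.sum_add_distrib, ← Finset.mul_sum] at hle
    rw [h] at hle
    have e1 := aux_energy G R i hi.1.2.1
    have e2 := aux_energy G R j hj.1.2.1
    linarith
  unfold Reff
  rw [if_neg hab]
  symm
  refine IsLeast.csInf_eq ⟨⟨i, hi, rfl⟩, ?_⟩
  rintro E ⟨j, hj, rfl⟩
  exact hmin j hj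
end

section
/- Thomson's principle: let G=(V,E) be a finite simple connected graph with edge resistances R: E→(0,∞), let a ≠ b be vertices, and let i be a unit current flow from a to b. Then for every unit flow j from a to b one has Energy(i) ≤ Energy(j), with equality if and only if j = i. In particular the unit current flow is the unique energy-minimizing unit flow from a to b. -/
open scoped BigOperators

theorem flowDiv_eq_sum {V : Type*} [Fintype V] (G : SimpleGraph V) (j : V → V → ℝ)
    (h : ∀ x y, ¬ G.Adj x y → j x y = 0) (x : V) : flowDiv G j x = ∑ y, j x y := by
  unfold flowDiv
  rw [← finsum_eq_sum_of_fintype]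
  refine finsum_congr fun y => ?_
  by_cases hy : G.Adj x y
  · simp [hy]
  · simp [hy, h x y hy]

theorem energy_eq_sum {V : Type*} [Fintype V] (G : SimpleGraph V) (R : Sym2 V → ℝ)
    (j : V → V → ℝ) (h : ∀ x y, ¬ G.Adj x y → j x y = 0) :
    energy G R j = (1 / 2) * ∑ x, ∑ y, R s(x, y) * (j x y) ^ 2 := by
  unfold energy
  rw [← finsum_eq_sum_of_fintype]
  congr 1
  refine finsum_congr fun x => ?_
  rw [← finsum_eq_sum_of_fintype]
  refine finsum_congr fun y => ?_
  by_cases hy : G.Adj x y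
  · simp [hy]
  · simp [hy, h x y hy]

theorem thomson_principle {V : Type*} [Fintype V] (G : SimpleGraph V)
    (hG : G.Connected) (R : Sym2 V → ℝ) (hR : ∀ e ∈ G.edgeSet, 0 < R e)
    (a b : V) (hab : a ≠ b) (i : V → V → ℝ)
    (hi : IsUnitFlow G a b i)
    (hOhm : ∃ v : V → ℝ, ∀ x y, G.Adj x y → i x y = (v y - v x) / R s(x, y)) :
    ∀ j : V → V → ℝ, IsUnitFlow G a b j →
      energy G R i ≤ energy G R j ∧ (energy G R i = energy G R j ↔ j = i) := by
  obtain ⟨v, hv⟩ := hOhm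
  intro j hj
  obtain ⟨⟨ia, iz, idv⟩, iu⟩ := hi
  obtain ⟨⟨ja, jz, jdv⟩, ju⟩ := hj
  simp only [flowDiv_eq_sum G i iz] at idv iu
  simp only [flowDiv_eq_sum G j jz] at jdv ju
  rw [energy_eq_sum G R i iz, energy_eq_sum G R j jz]
  obtain ⟨d, hd⟩ : ∃ d : V → V → ℝ, ∀ x y, d x y = j x y - i x y := ⟨_, fun _ _ => rfl⟩
  have da : ∀ x y, d x y = - d y x := fun x y => by
    rw [hd, hd, ja x y, ia x y]; ring
  have dz : ∀ x y, ¬ G.Adj x y → d x y = 0 := fun x y h => by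
    rw [hd, jz x y h, iz x y h, sub_zero]
  have d0 : ∀ x, x ≠ b → ∑ y, d x y = 0 := fun x hx => by
    simp only [hd, Finset.sum_sub_distrib]
    by_cases hxa : x = a
    · subst hxa; rw [iu, ju, sub_self]
    · rw [idv x hxa hx, jdv x hxa hx, sub_self]
  have dtot : ∑ x, ∑ y, d x y = 0 := by
    have h1 : ∑ x, ∑ y, d x y = - ∑ x, ∑ y, d x y := by
      conv_lhs => rw [Finset.sum_comm]
      simp only [← Finset.sum_neg_distrib]
      exact Finset.sum_congr rfl fun x _ => Finset.sum_congr rfl fun y _ => da y x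
    linarith
  have db : ∀ x, ∑ y, d x y = 0 := fun x => by
    by_cases hx : x = b
    · subst hx
      rw [← dtot]
      exact (Finset.sum_eq_single x (fun y _ hy => d0 y hy) (by simp)).symm
    · exact d0 x hx
  have key : ∀ x y, R s(x, y) * i x y * d x y = v y * d x y - v x * d x y := fun x y => by
    by_cases h : G.Adj x y
    · have := (hR s(x, y) h).ne'
      rw [hv x y h]; field_simp
    · rw [dz x y h]; ring
  have cross : ∑ x, ∑ y, R s(x, y) * i x y * d x y = 0 := by
    have h1 : ∑ x, ∑ y, v x * d x y = 0 := by
      simp only [← Finset.mul_sum, db, mul_zero, Finset.sum_const_zero]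
    have h2 : ∑ x, ∑ y, v y * d x y = 0 := by
      rw [Finset.sum_comm]
      simp only [← Finset.mul_sum]
      refine Finset.sum_eq_zero fun y _ => ?_
      have : ∑ x, d x y = - ∑ x, d y x := by
        rw [← Finset.sum_neg_distrib]
        exact Finset.sum_congr rfl fun x _ => da x y
      rw [this, db]; simp
    simp only [key, Finset.sum_sub_distrib, h1, h2, sub_self]
  have expand : ∑ x, ∑ y, R s(x, y) * (j x y) ^ 2 = ∑ x, ∑ y, R s(x, y) * (i x y) ^ 2
      + ∑ x, ∑ y, R s(x, y) * (d x y) ^ 2 := by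
    have : ∑ x, ∑ y, R s(x, y) * (j x y) ^ 2 = ∑ x, ∑ y, R s(x, y) * (i x y) ^ 2
      + ∑ x, ∑ y, R s(x, y) * (d x y) ^ 2 + 2 * ∑ x, ∑ y, R s(x, y) * i x y * d x y := by
      simp only [Finset.mul_sum, ← Finset.sum_add_distrib]
      refine Finset.sum_congr rfl fun x _ => Finset.sum_congr rfl fun y _ => ?_
      rw [hd]; ring
    rw [this, cross]; ring
  have nn : ∀ x y, 0 ≤ R s(x, y) * (d x y) ^ 2 := fun x y => by
    by_cases h : G.Adj x y
    · exact mul_nonneg (hR s(x, y) h).le (sq_nonneg _)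
    · rw [dz x y h]; simp
  have nn1 : ∀ x, 0 ≤ ∑ y, R s(x, y) * (d x y) ^ 2 := fun x => Finset.sum_nonneg fun y _ => nn x y
  have nn2 : 0 ≤ ∑ x, ∑ y, R s(x, y) * (d x y) ^ 2 := Finset.sum_nonneg fun x _ => nn1 x
  refine ⟨by linarith, fun h => ?_, fun h => by rw [h]⟩
  have h0 : ∑ x, ∑ y, R s(x, y) * (d x y) ^ 2 = 0 := by linarith
  funext x y
  have h1 := (Finset.sum_eq_zero_iff_of_nonneg fun x _ => nn1 x).1 h0 x (Finset.mem_univ x)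
  have h2 := (Finset.sum_eq_zero_iff_of_nonneg fun y _ => nn x y).1 h1 y (Finset.mem_univ y)
  by_cases h : G.Adj x y
  · have hd0 : d x y = 0 := by simpa [(hR s(x, y) h).ne'] using h2
    rw [hd] at hd0; linarith
  · rw [jz x y h, iz x y h]
end

section
/- Modulus equals capacity: let G=(V,E) be a finite simple connected graph and let a ≠ b be vertices. Then Mod(a,b) = Cap(a,b). -/
open scoped BigOperators

/-- The squared gradient of `u`, as a function on unordered pairs. -/
noncomputable def gradSq {V : Type*} (u : V → ℝ) : Sym2 V → ℝ :=
  Sym2.lift ⟨fun x y => (u x - u y) ^ 2, fun a b => by ring⟩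

/-- The capacity `Cap(a,b)`: the least energy `Σ_{{x,y}∈E} (u x − u y)²` over functions
`u` with `u a = 0` and `u b = 1`. -/
noncomputable def capacity {V : Type*} (G : SimpleGraph V) (a b : V) : ℝ :=
  sInf {E | ∃ u : V → ℝ, u a = 0 ∧ u b = 1 ∧ E = ∑ᶠ e ∈ G.edgeSet, gradSq u e}

/-- The `ρ`-length of a curve (connected subgraph) `γ`: the sum of `ρ` over its edges. -/
noncomputable def rhoLength {V : Type*} {G : SimpleGraph V} (γ : G.Subgraph)
    (ρ : Sym2 V → ℝ) : ℝ :=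
  ∑ᶠ e ∈ γ.edgeSet, ρ e

/-- `ρ` is admissible for `Γ(a,b)`: every connected subgraph containing `a` and `b`
has `ρ`-length at least `1`. -/
def Admissible {V : Type*} (G : SimpleGraph V) (a b : V) (ρ : Sym2 V → ℝ) : Prop :=
  ∀ γ : G.Subgraph, γ.Connected → a ∈ γ.verts → b ∈ γ.verts → 1 ≤ rhoLength γ ρ

/-- The modulus `Mod(a,b)`: the infimum of `Σ_{e∈E} ρ(e)²` over admissible densities. -/
noncomputable def modulus {V : Type*} (G : SimpleGraph V) (a b : V) : ℝ :=
  sInf {m | ∃ ρ : Sym2 V → ℝ, (∀ e ∈ G.edgeSet, 0 ≤ ρ e) ∧ Admissible G a b ρ ∧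
    m = ∑ᶠ e ∈ G.edgeSet, (ρ e) ^ 2}

lemma mec_walk_abs {V : Type*} {G : SimpleGraph V} (u : V → ℝ) {x y : V} (p : G.Walk x y) :
    |u x - u y| ≤ (p.edges.map (fun e => Real.sqrt (gradSq u e))).sum := by
  induction p with
  | nil => simp
  | @cons x y z h p ih =>
    have h1 : Real.sqrt (gradSq u s(x, y)) = |u x - u y| := Real.sqrt_sq_eq_abs _
    simp only [SimpleGraph.Walk.edges_cons, List.map_cons, List.sum_cons, h1]
    exact (abs_sub_le _ (u y) _).trans (by linarith)

lemma mec_finsum_le {V : Type*} [Fintype V] (S : Set (Sym2 V)) (f g : Sym2 V → ℝ)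
    (h : ∀ e ∈ S, f e ≤ g e) : ∑ᶠ e ∈ S, f e ≤ ∑ᶠ e ∈ S, g e := by
  classical
  rw [finsum_mem_eq_finite_toFinset_sum f S.toFinite, finsum_mem_eq_finite_toFinset_sum g S.toFinite]
  exact Finset.sum_le_sum (fun e he => h e (by simpa using he))

lemma mec_finsum_nonneg {V : Type*} (S : Set (Sym2 V)) (f : Sym2 V → ℝ)
    (h : ∀ e ∈ S, 0 ≤ f e) : 0 ≤ ∑ᶠ e ∈ S, f e :=
  finsum_nonneg (fun e => finsum_nonneg (fun he => h e he))

lemma mec_gradSq_nonneg {V : Type*} (u : V → ℝ) (e : Sym2 V) : 0 ≤ gradSq u e := by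
  induction e with
  | _ x y => exact sq_nonneg (u x - u y)

lemma mec_adm {V : Type*} [Fintype V] (G : SimpleGraph V) (a b : V) (u : V → ℝ)
    (ha : u a = 0) (hb : u b = 1) : Admissible G a b (fun e => Real.sqrt (gradSq u e)) := by
  classical
  intro γ hγ haγ hbγ
  obtain ⟨q⟩ := hγ.coe.preconnected ⟨a, haγ⟩ ⟨b, hbγ⟩
  let q' : G.Walk a b := q.map γ.hom
  have hq' : ∀ e ∈ q'.edges, e ∈ γ.edgeSet := by
    intro e he
    have he : e ∈ (q.map γ.hom).edges := he
    rw [SimpleGraph.Walk.edges_map, List.mem_map] at he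
    obtain ⟨e', he', rfl⟩ := he
    have := q.edges_subset_edgeSet he'
    induction e' with
    | _ x y => simpa using this
  have h1 := mec_walk_abs u q'.bypass
  rw [ha, hb] at h1
  have hnd := (q'.bypass_isPath).isTrail.edges_nodup
  rw [← List.sum_toFinset _ hnd] at h1
  unfold rhoLength
  rw [finsum_mem_eq_finite_toFinset_sum _ γ.edgeSet.toFinite]
  have h2 : (1:ℝ) = |0 - 1| := by norm_num
  rw [h2]
  refine h1.trans (Finset.sum_le_sum_of_subset_of_nonneg ?_ (fun _ _ _ => Real.sqrt_nonneg _))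
  intro e he
  simp only [List.mem_toFinset] at he
  simpa using hq' e (q'.edges_bypass_subset he)

lemma mec_pot {V : Type*} [Fintype V] (G : SimpleGraph V) (hG : G.Connected) (a b : V)
    (ρ : Sym2 V → ℝ) (h0 : ∀ e ∈ G.edgeSet, 0 ≤ ρ e) (hρ : Admissible G a b ρ) :
    ∃ u : V → ℝ, u a = 0 ∧ u b = 1 ∧ ∀ e ∈ G.edgeSet, gradSq u e ≤ ρ e ^ 2 := by
  classical
  have hnn : ∀ x (p : G.Walk a x), 0 ≤ (p.edges.map ρ).sum := by
    intro x p
    apply List.sum_nonneg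
    intro r hr
    obtain ⟨e, he, rfl⟩ := List.mem_map.1 hr
    exact h0 e (p.edges_subset_edgeSet he)
  let d : V → ℝ := fun x => ⨅ p : G.Walk a x, (p.edges.map ρ).sum
  have hne : ∀ x, Nonempty (G.Walk a x) := fun x => hG.preconnected a x
  have hbdd : ∀ x, BddBelow (Set.range fun p : G.Walk a x => (p.edges.map ρ).sum) := by
    intro x
    refine ⟨0, ?_⟩
    rintro _ ⟨p, rfl⟩
    exact hnn x p
  have hda : d a = 0 := by
    apply le_antisymm
    · exact (ciInf_le (hbdd a) SimpleGraph.Walk.nil).trans (by simp)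
    · exact le_ciInf (hnn a)
  have hdb : 1 ≤ d b := by
    apply le_ciInf
    intro p
    refine (hρ p.toSubgraph p.toSubgraph_connected (by simp) (by simp)).trans ?_
    unfold rhoLength
    rw [finsum_mem_eq_finite_toFinset_sum _ p.toSubgraph.edgeSet.toFinite]
    have hE : (p.toSubgraph.edgeSet.toFinite).toFinset = p.edges.toFinset := by
      ext e; simp
    rw [hE, Finset.sum_list_map_count]
    apply Finset.sum_le_sum
    intro e he
    rw [List.mem_toFinset] at he
    have h1 : 1 ≤ p.edges.count e := List.one_le_count_iff.2 he
    have h2 : (1:ℝ) ≤ p.edges.count e := by exact_mod_cast h1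
    have h3 := h0 e (p.edges_subset_edgeSet he)
    rw [nsmul_eq_mul]
    nlinarith
  have hstep : ∀ x y, G.Adj x y → d y ≤ d x + ρ s(x, y) := by
    intro x y h
    rw [← sub_le_iff_le_add]
    apply le_ciInf
    intro p
    rw [sub_le_iff_le_add]
    refine (ciInf_le (hbdd y) (p.concat h)).trans ?_
    simp [SimpleGraph.Walk.edges_concat, List.concat_eq_append]
  refine ⟨fun x => min 1 (d x), by simp [hda], by simp [hdb], ?_⟩
  intro e he
  induction e with
  | _ x y =>
    have h : G.Adj x y := he
    have h1 := hstep x y h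
    have h2 := hstep y x h.symm
    rw [Sym2.eq_swap] at h2
    have h3 := h0 _ he
    change (min 1 (d x) - min 1 (d y)) ^ 2 ≤ _
    apply sq_le_sq'
    · rcases min_cases 1 (d x) with h | h <;> rcases min_cases 1 (d y) with h' | h' <;> linarith
    · rcases min_cases 1 (d x) with h | h <;> rcases min_cases 1 (d y) with h' | h' <;> linarith

theorem modulus_eq_capacity {V : Type*} [Fintype V] (G : SimpleGraph V)
    (hG : G.Connected) (a b : V) (hab : a ≠ b) :
    modulus G a b = capacity G a b := by
  classical
  have hcap : ∀ u : V → ℝ, u a = 0 → u b = 1 →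
      modulus G a b ≤ ∑ᶠ e ∈ G.edgeSet, gradSq u e := by
    intro u ha hb
    refine csInf_le ⟨0, ?_⟩ ⟨fun e => Real.sqrt (gradSq u e), fun e _ => Real.sqrt_nonneg _,
      mec_adm G a b u ha hb, ?_⟩
    · rintro _ ⟨ρ, -, -, rfl⟩
      exact mec_finsum_nonneg _ _ (fun e _ => sq_nonneg _)
    · simp only [Real.sq_sqrt (mec_gradSq_nonneg u _)]
  have hu : ∃ u : V → ℝ, u a = 0 ∧ u b = 1 :=
    ⟨fun x => if x = b then 1 else 0, by simp [hab], by simp⟩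
  obtain ⟨u, ha, hb⟩ := hu
  apply le_antisymm
  · refine le_csInf ⟨_, u, ha, hb, rfl⟩ ?_
    rintro _ ⟨u, ha, hb, rfl⟩
    exact hcap u ha hb
  · refine le_csInf ⟨_, fun e => Real.sqrt (gradSq u e), fun e _ => Real.sqrt_nonneg _,
      mec_adm G a b u ha hb, rfl⟩ ?_
    rintro _ ⟨ρ, h0, hρ, rfl⟩
    obtain ⟨v, hva, hvb, hv⟩ := mec_pot G hG a b ρ h0 hρ
    refine le_trans ?_ (mec_finsum_le _ _ _ hv)
    refine csInf_le ⟨0, ?_⟩ ⟨v, hva, hvb, rfl⟩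
    rintro _ ⟨w, -, -, rfl⟩
    exact mec_finsum_nonneg _ _ (fun e _ => mec_gradSq_nonneg w e)
end

section
/- Let G=(V,E) be a finite simple connected graph and let a ≠ b be vertices. Then d_G(a,b)²·Mod(a,b) ≤ Epidemic(a,b). -/
open scoped BigOperators

lemma walk_pot {V : Type*} (H : SimpleGraph V) (g : V → ℝ) (ρ : Sym2 V → ℝ)
    (h : ∀ u v, H.Adj u v → g v - g u ≤ ρ s(u, v)) {u v : V} (p : H.Walk u v) :
    g v - g u ≤ (p.edges.map ρ).sum := by
  induction p with
  | nil => simp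
  | cons hadj p ih =>
    have := h _ _ hadj
    simp only [SimpleGraph.Walk.edges_cons, List.map_cons, List.sum_cons]
    linarith

lemma pot_le_rhoLength {V : Type*} [Fintype V] (G : SimpleGraph V) (γ : G.Subgraph)
    (hγ : γ.Connected) (g : V → ℝ) (ρ : Sym2 V → ℝ) (h0 : ∀ e, 0 ≤ ρ e)
    (h : ∀ u v, G.Adj u v → g v - g u ≤ ρ s(u, v)) {a b : V} (ha : a ∈ γ.verts)
    (hb : b ∈ γ.verts) : g b - g a ≤ rhoLength γ ρ := by
  classical
  have hr : γ.spanningCoe.Reachable a b := by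
    have h1 := hγ.coe.preconnected ⟨a, ha⟩ ⟨b, hb⟩
    let φ : γ.coe →g γ.spanningCoe := ⟨fun x => x.1, fun {x y} hxy => hxy⟩
    exact h1.map φ
  obtain ⟨p, hp⟩ := hr.exists_isPath
  refine (walk_pot γ.spanningCoe g ρ (fun u v huv => h u v (γ.adj_sub huv)) p).trans ?_
  rw [← List.sum_toFinset _ hp.isTrail.edges_nodup]
  have hfin : γ.edgeSet.Finite := Set.toFinite _
  unfold rhoLength
  rw [finsum_mem_eq_finite_toFinset_sum _ hfin]
  apply Finset.sum_le_sum_of_subset_of_nonneg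
  · intro e he
    have := p.edges_subset_edgeSet (List.mem_toFinset.1 he)
    simpa using this
  · intros; exact h0 _

theorem dist_sq_mul_modulus_le_epidemic {V : Type*} [Fintype V]
    (G : SimpleGraph V) (hG : G.Connected) (a b : V) (hab : a ≠ b) :
    (G.dist a b : ℝ) ^ 2 * modulus G a b ≤ (epidemic G a b : ℝ) := by
  classical
  set d := G.dist a b with hd
  have hdpos : 0 < d := hG.pos_dist_of_ne hab
  have hdR : (0 : ℝ) < d := by exact_mod_cast hdpos
  set B : Set (Sym2 V) := {e ∈ G.edgeSet | ∀ v ∈ e, G.dist a v ≤ d} with hB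
  let ρ : Sym2 V → ℝ := fun e => if e ∈ B then (1 : ℝ) / d else 0
  have h0 : ∀ e, 0 ≤ ρ e := by
    intro e; dsimp only [ρ]; split_ifs <;> positivity
  let g : V → ℝ := fun v => ((min (G.dist a v) d : ℕ) : ℝ) / d
  have hg : ∀ u v, G.Adj u v → g v - g u ≤ ρ s(u, v) := by
    intro u v huv
    have hv : G.dist a v ≤ G.dist a u + 1 := by
      have := hG.dist_triangle (u := a) (v := u) (w := v)
      rwa [SimpleGraph.dist_eq_one_iff_adj.2 huv] at this
    dsimp only [g, ρ]
    rw [← sub_div]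
    split_ifs with he
    · apply div_le_div_of_nonneg_right _ hdR.le
      have : min (G.dist a v) d ≤ min (G.dist a u) d + 1 := by omega
      have : ((min (G.dist a v) d : ℕ) : ℝ) ≤ (min (G.dist a u) d : ℕ) + 1 := by exact_mod_cast this
      linarith
    · apply div_nonpos_of_nonpos_of_nonneg _ hdR.le
      have hn : ¬ (G.dist a u ≤ d ∧ G.dist a v ≤ d) := by
        rintro ⟨h1, h2⟩
        apply he
        refine ⟨huv, ?_⟩
        intro w hw
        rcases Sym2.mem_iff.1 hw with rfl | rfl <;> assumption
      have : min (G.dist a v) d ≤ min (G.dist a u) d := by omega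
      have : ((min (G.dist a v) d : ℕ) : ℝ) ≤ (min (G.dist a u) d : ℕ) := by exact_mod_cast this
      linarith
  have hadm : Admissible G a b ρ := by
    intro γ hγ ha hb
    have := pot_le_rhoLength G γ hγ g ρ h0 hg ha hb
    have e : g b - g a = 1 := by
      dsimp only [g]
      rw [← hd]
      simp [hdR.ne']
    linarith
  have hsum : ∑ᶠ e ∈ G.edgeSet, (ρ e) ^ 2 = (B.ncard : ℝ) / d ^ 2 := by
    have hfin : G.edgeSet.Finite := Set.toFinite _
    have hBf : B.Finite := Set.toFinite _
    rw [finsum_mem_eq_finite_toFinset_sum _ hfin, Set.ncard_eq_toFinset_card B hBf]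
    have hsub : hBf.toFinset ⊆ hfin.toFinset := by
      intro e he
      simp only [Set.Finite.mem_toFinset] at he ⊢
      exact he.1
    rw [← Finset.sum_subset hsub]
    · rw [Finset.sum_congr rfl (g := fun _ => (1 : ℝ) / d ^ 2)]
      · simp [div_eq_mul_inv]
      · intro e he
        have : e ∈ B := by simpa only [Set.Finite.mem_toFinset] using he
        simp [ρ, this]
    · intro e _ he
      have : e ∉ B := by simpa only [Set.Finite.mem_toFinset] using he
      simp [ρ, this]
  have hmod : modulus G a b ≤ (B.ncard : ℝ) / d ^ 2 := by
    apply csInf_le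
    · refine ⟨0, ?_⟩
      rintro m ⟨σ, _, _, rfl⟩
      exact finsum_nonneg (fun _ => finsum_nonneg (fun _ => sq_nonneg _))
    · exact ⟨ρ, fun e _ => h0 e, hadm, hsum.symm⟩
  have hle : (B.ncard : ℝ) ≤ epidemic G a b := by
    have : B.ncard ≤ epidemic G a b := Nat.le_add_right _ _
    exact_mod_cast this
  calc (d : ℝ) ^ 2 * modulus G a b ≤ d ^ 2 * ((B.ncard : ℝ) / d ^ 2) := by gcongr
    _ = (B.ncard : ℝ) := by field_simp
    _ ≤ _ := hle
end

section
/- Let P_N be the path graph on N vertices x_1, …, x_N (with edges {x_k, x_{k+1}} for k = 1, …, N−1). Then for all indices 1 ≤ i < j ≤ N, the epidemic quasimetric satisfies Epidemic(x_i, x_j) = min{j−i, i−1} + 2(j−i) + min{j−i, N−j}. -/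
open scoped BigOperators

theorem pg_walk {N : ℕ} {u v : Fin N} (p : (SimpleGraph.pathGraph N).Walk u v) :
    (u.val - v.val) + (v.val - u.val) ≤ p.length := by
  induction p with
  | nil => simp
  | cons h p ih =>
    rw [SimpleGraph.pathGraph_adj] at h
    rw [SimpleGraph.Walk.length_cons]
    omega

theorem pg_walk_exists {N : ℕ} (k : ℕ) : ∀ u v : Fin N, u.val + k = v.val →
    ∃ p : (SimpleGraph.pathGraph N).Walk u v, p.length = k := by
  induction k with
  | zero =>
    intro u v h
    obtain rfl : u = v := Fin.ext (by omega)
    exact ⟨.nil, rfl⟩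
  | succ k ih =>
    intro u v h
    have hv := v.isLt
    obtain ⟨p, hp⟩ := ih ⟨u.val + 1, by omega⟩ v (by simp only; omega)
    refine ⟨.cons (SimpleGraph.pathGraph_adj.2 (Or.inl rfl)) p, ?_⟩
    rw [SimpleGraph.Walk.length_cons, hp]

theorem pg_dist {N : ℕ} (u v : Fin N) :
    (SimpleGraph.pathGraph N).dist u v = (u.val - v.val) + (v.val - u.val) := by
  apply le_antisymm
  · rcases le_total u.val v.val with h | h
    · obtain ⟨p, hp⟩ := pg_walk_exists (v.val - u.val) u v (by omega)
      have := SimpleGraph.dist_le p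
      omega
    · obtain ⟨p, hp⟩ := pg_walk_exists (u.val - v.val) v u (by omega)
      have := SimpleGraph.dist_le p
      rw [SimpleGraph.dist_comm]
      omega
  · obtain ⟨p, hp⟩ := (SimpleGraph.pathGraph_preconnected N u v).exists_walk_length_eq_dist
    rw [← hp]
    exact pg_walk p

theorem pg_ball {N : ℕ} (x : Fin N) (r : ℕ) :
    ballEdges (SimpleGraph.pathGraph N) x r = min r x.val + min r (N - 1 - x.val) := by
  have hx := x.isLt
  have key : (↑(Finset.Ico (x.val - r) (min (x.val + r) (N - 1))) : Set ℕ).ncard =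
      ballEdges (SimpleGraph.pathGraph N) x r := by
    unfold ballEdges
    refine Set.ncard_congr (fun k hk => s(⟨k, ?_⟩, ⟨k + 1, ?_⟩)) ?_ ?_ ?_
    · simp at hk; omega
    · simp at hk; omega
    · intro k hk
      simp at hk
      simp [SimpleGraph.pathGraph_adj, pg_dist]
      omega
    · intro a b ha hb h
      simp at h
      omega
    · intro e
      induction e with
      | h a b =>
        intro he
        simp [SimpleGraph.pathGraph_adj, pg_dist] at he
        have := a.isLt
        have := b.isLt
        rcases he.1 with h | h
        · refine ⟨a.val, by simp; omega, ?_⟩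
          simp [Fin.ext_iff]; omega
        · refine ⟨b.val, by simp; omega, ?_⟩
          simp [Fin.ext_iff]; omega
  rw [← key, Set.ncard_coe_finset, Nat.card_Ico]
  omega

theorem path_graph_epidemic (N i j : ℕ) (hi : 1 ≤ i) (hij : i < j) (hj : j ≤ N) :
    epidemic (SimpleGraph.pathGraph N) ⟨i - 1, by omega⟩ ⟨j - 1, by omega⟩ =
      min (j - i) (i - 1) + 2 * (j - i) + min (j - i) (N - j) := by
  unfold epidemic
  rw [pg_ball, pg_ball, pg_dist]
  simp only
  omega
end
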